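/- The number of conjugacy classes of centralizers of elements in SU(3, ℂ) is exactly three; that is, the set of subgroups of SU(3, ℂ) of the form Z(A) = {g ∈ SU(3, ℂ) | gA = Ag} for some A ∈ SU(3, ℂ), considered up to conjugation by elements of SU(3, ℂ), has exactly 3 elements. -/

import Mathlib

open Matrix

/-- The special unitary group `SU(3, ℂ)` as a set of matrices. -/
def SU3 : Set (Matrix (Fin 3) (Fin 3) ℂ) :=
  {g | gᴴ * g = 1 ∧ g.det = 1}

/-- The centralizer of `A` in `SU(3, ℂ)`. -/
def centralizerSU3 (A : Matrix (Fin 3) (Fin 3) ℂ) : Set (Matrix (Fin 3) (Fin 3) ℂ) :=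
  {g | g ∈ SU3 ∧ g * A = A * g}

/-- Two subsets of `SU(3, ℂ)` are conjugate if one is carried onto the other by
conjugation by an element of `SU(3, ℂ)`. -/
noncomputable def ConjugateInSU3 (S T : Set (Matrix (Fin 3) (Fin 3) ℂ)) : Prop :=
  ∃ g ∈ SU3, (fun x => g * x * g⁻¹) '' S = T

/-- A unitary matrix over `ℂ` is diagonalized by a unitary matrix: its Cayley transform at a point
of the unit circle outside of the spectrum is Hermitian. -/
theorem Matrix.exists_unitary_conj_eq_diagonal {n : Type*} [Fintype n] [DecidableEq n]
    {A : Matrix n n ℂ} (hA : A ∈ unitaryGroup n ℂ) :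
    ∃ U ∈ unitaryGroup n ℂ, ∃ d : n → ℂ, Uᴴ * A * U = diagonal d := by
  have hAA : Aᴴ * A = 1 := mem_unitaryGroup_iff'.mp hA
  obtain ⟨z, hz⟩ : ∃ z : Circle, (z : ℂ) ∉ spectrum ℂ A := by
    have : Infinite (Set.Ioc (-Real.pi) Real.pi) :=
      (Set.Ioc_infinite (by linarith [Real.pi_pos])).to_subtype
    have : Infinite Circle := .of_injective _ Circle.argEquiv.symm.injective
    have hfin : {z : Circle | (z : ℂ) ∈ spectrum ℂ A}.Finite :=
      A.finite_spectrum.preimage Circle.coe_injective.injOn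
    exact hfin.infinite_compl.nonempty
  have hzz : star (z : ℂ) * z = 1 := by
    simp [mul_comm, Complex.mul_conj]
  set B : Matrix n n ℂ := (z : ℂ) • 1 - A with hB
  set C : Matrix n n ℂ := (z : ℂ) • 1 + A with hC
  have hBu : IsUnit B := by
    simpa [spectrum.mem_iff, Algebra.algebraMap_eq_smul_one] using hz
  have hBd : IsUnit B.det := (isUnit_iff_isUnit_det B).mp hBu
  have hBhd : IsUnit Bᴴ.det := by
    rw [det_conjTranspose]
    exact hBd.star
  have hBC : Bᴴ * C = -(Cᴴ * B) := by
    simp only [hB, hC, conjTranspose_sub, conjTranspose_add, conjTranspose_smul,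
      conjTranspose_one, sub_mul, add_mul, mul_sub, mul_add, smul_mul_assoc, mul_smul_comm,
      one_mul, mul_one, hAA]
    match_scalars
    · linear_combination 2 * hzz
    all_goals ring
  set H : Matrix n n ℂ := Complex.I • (C * B⁻¹) with hH
  have hHB : H * B = Complex.I • C := by
    rw [hH, smul_mul_assoc, nonsing_inv_mul_cancel_right _ _ hBd]
  have hHerm : H.IsHermitian := by
    have h : B⁻¹ᴴ * Cᴴ = -(C * B⁻¹) := by
      rw [conjTranspose_nonsing_inv]
      calc Bᴴ⁻¹ * Cᴴ = Bᴴ⁻¹ * ((Cᴴ * B) * B⁻¹) := by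
            rw [mul_nonsing_inv_cancel_right _ _ hBd]
        _ = -(Bᴴ⁻¹ * (Bᴴ * (C * B⁻¹))) := by
            rw [← neg_eq_iff_eq_neg.mpr hBC]; simp [Matrix.mul_assoc]
        _ = _ := by rw [nonsing_inv_mul_cancel_left _ _ hBhd]
    rw [IsHermitian, hH, conjTranspose_smul, conjTranspose_mul, h]
    simp
  set U : Matrix n n ℂ := hHerm.eigenvectorUnitary.1
  have hUm : U ∈ unitaryGroup n ℂ := hHerm.eigenvectorUnitary.2
  have hUU : U * Uᴴ = 1 := mem_unitaryGroup_iff.mp hUm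
  have hUU' : Uᴴ * U = 1 := mem_unitaryGroup_iff'.mp hUm
  have hD : Uᴴ * H * U = diagonal (fun i => (hHerm.eigenvalues i : ℂ)) := by
    have := hHerm.conjStarAlgAut_star_eigenvectorUnitary
    rw [Unitary.conjStarAlgAut_star_apply] at this
    exact this
  have key : diagonal (fun i => (hHerm.eigenvalues i : ℂ)) * ((z : ℂ) • 1 - Uᴴ * A * U) =
      Complex.I • ((z : ℂ) • 1 + Uᴴ * A * U) := by
    have h1 : (z : ℂ) • 1 - Uᴴ * A * U = Uᴴ * B * U := by
      simp [hB, mul_sub, sub_mul, hUU']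
    have h2 : (z : ℂ) • 1 + Uᴴ * A * U = Uᴴ * C * U := by
      simp [hC, mul_add, add_mul, hUU']
    rw [h1, h2, ← hD]
    calc Uᴴ * H * U * (Uᴴ * B * U) = Uᴴ * H * (U * Uᴴ) * B * U := by
          simp only [Matrix.mul_assoc]
      _ = Uᴴ * (H * B) * U := by rw [hUU]; simp only [Matrix.mul_assoc, Matrix.one_mul]
      _ = _ := by rw [hHB]; simp
  refine ⟨U, hUm, diag (Uᴴ * A * U), ?_⟩
  refine ((isDiag_iff_diagonal_diag _).mp fun i j hij => ?_).symm
  have h := congr_fun (congr_fun key i) j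
  simp only [diagonal_mul, sub_apply, add_apply, smul_apply, one_apply_ne hij,
    smul_eq_mul] at h
  have h' : ((hHerm.eigenvalues i : ℂ) + Complex.I) * (Uᴴ * A * U) i j = 0 := by
    linear_combination -h
  refine (mul_eq_zero.mp h').resolve_left fun h0 => ?_
  simpa using congr_arg Complex.im h0

namespace SU3

variable {A B g h : Matrix (Fin 3) (Fin 3) ℂ}

theorem eq_specialUnitaryGroup : SU3 = specialUnitaryGroup (Fin 3) ℂ := by
  ext g
  simp [SU3, mem_specialUnitaryGroup_iff, mem_unitaryGroup_iff', star_eq_conjTranspose]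

theorem mul_mem (hg : g ∈ SU3) (hh : h ∈ SU3) : g * h ∈ SU3 := by
  rw [eq_specialUnitaryGroup] at *
  exact Submonoid.mul_mem _ hg hh

theorem inv_eq (hg : g ∈ SU3) : g⁻¹ = gᴴ :=
  inv_eq_left_inv hg.1

theorem inv_mem (hg : g ∈ SU3) : g⁻¹ ∈ SU3 := by
  rw [inv_eq hg]
  rw [eq_specialUnitaryGroup] at *
  exact (star (⟨g, hg⟩ : specialUnitaryGroup (Fin 3) ℂ)).2

theorem isUnit_det (hg : g ∈ SU3) : IsUnit g.det := by
  simp [hg.2]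

theorem inv_mul (hg : g ∈ SU3) : g⁻¹ * g = 1 :=
  nonsing_inv_mul _ (isUnit_det hg)

theorem mul_inv (hg : g ∈ SU3) : g * g⁻¹ = 1 :=
  mul_nonsing_inv _ (isUnit_det hg)

theorem inv_inv (hg : g ∈ SU3) : g⁻¹⁻¹ = g :=
  nonsing_inv_nonsing_inv _ (isUnit_det hg)

theorem conj_mem (hg : g ∈ SU3) (hA : A ∈ SU3) : g * A * g⁻¹ ∈ SU3 :=
  mul_mem (mul_mem hg hA) (inv_mem hg)

theorem conj_mul_conj (hg : g ∈ SU3) : g * A * g⁻¹ * (g * B * g⁻¹) = g * (A * B) * g⁻¹ := by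
  calc g * A * g⁻¹ * (g * B * g⁻¹) = g * A * (g⁻¹ * g) * B * g⁻¹ := by
        simp only [Matrix.mul_assoc]
    _ = _ := by rw [inv_mul hg]; simp only [Matrix.mul_assoc, Matrix.one_mul]

theorem conj_inv_conj (hg : g ∈ SU3) : g * (g⁻¹ * A * g⁻¹⁻¹) * g⁻¹ = A := by
  calc g * (g⁻¹ * A * g⁻¹⁻¹) * g⁻¹ = (g * g⁻¹) * A * (g * g⁻¹) := by
        rw [inv_inv hg]; simp only [Matrix.mul_assoc]
    _ = A := by rw [mul_inv hg, Matrix.one_mul, Matrix.mul_one]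

theorem conj_mem_centralizer (hg : g ∈ SU3) (hh : h ∈ centralizerSU3 A) :
    g * h * g⁻¹ ∈ centralizerSU3 (g * A * g⁻¹) :=
  ⟨conj_mem hg hh.1, by rw [conj_mul_conj hg, conj_mul_conj hg, hh.2]⟩

theorem conjugate_centralizer_conj (hg : g ∈ SU3) :
    ConjugateInSU3 (centralizerSU3 A) (centralizerSU3 (g * A * g⁻¹)) := by
  refine ⟨g, hg, Set.Subset.antisymm ?_ fun h hh => ?_⟩
  · rintro _ ⟨h, hh, rfl⟩
    exact conj_mem_centralizer hg hh
  · refine ⟨g⁻¹ * h * g⁻¹⁻¹, ?_, conj_inv_conj hg⟩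
    have := conj_mem_centralizer (inv_mem hg) hh
    have hA : g⁻¹ * (g * A * g⁻¹) * g⁻¹⁻¹ = A := by
      simpa only [inv_inv hg] using conj_inv_conj (A := A) (inv_mem hg)
    rwa [hA] at this

theorem conjugate_trans {S T R : Set (Matrix (Fin 3) (Fin 3) ℂ)} (hST : ConjugateInSU3 S T)
    (hTR : ConjugateInSU3 T R) : ConjugateInSU3 S R := by
  obtain ⟨g, hg, rfl⟩ := hST
  obtain ⟨h, hh, rfl⟩ := hTR
  refine ⟨h * g, mul_mem hh hg, ?_⟩
  rw [Set.image_image]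
  simp only [Matrix.mul_inv_rev, Matrix.mul_assoc]

/-- Conjugate subsets of `SU(3, ℂ)` are simultaneously commutative. -/
theorem commute_of_conjugate {S T : Set (Matrix (Fin 3) (Fin 3) ℂ)} (hST : ConjugateInSU3 S T)
    (hT : ∀ x ∈ T, ∀ y ∈ T, x * y = y * x) {x y : Matrix (Fin 3) (Fin 3) ℂ} (hx : x ∈ S)
    (hy : y ∈ S) : x * y = y * x := by
  obtain ⟨g, hg, rfl⟩ := hST
  have h := hT _ (Set.mem_image_of_mem _ hx) _ (Set.mem_image_of_mem _ hy)
  simp only [conj_mul_conj hg] at h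
  have hu : IsUnit g := (isUnit_iff_isUnit_det g).mpr (isUnit_det hg)
  have hu' : IsUnit g⁻¹ := (isUnit_iff_isUnit_det _).mpr (isUnit_det (inv_mem hg))
  exact hu.mul_left_cancel (hu'.mul_right_cancel h)

theorem centralizer_one : centralizerSU3 1 = SU3 := by
  ext g
  simp [centralizerSU3]

/-- Only a central element has a centralizer conjugate to `SU(3, ℂ)`. -/
theorem commute_of_conjugate_one
    (h1 : ConjugateInSU3 (centralizerSU3 1) (centralizerSU3 A)) (hh : h ∈ SU3) :
    h * A = A * h := by
  obtain ⟨g, hg, hgA⟩ := h1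
  rw [centralizer_one] at hgA
  have : h ∈ centralizerSU3 A := by
    rw [← hgA]
    exact ⟨_, conj_mem (inv_mem hg) hh, conj_inv_conj hg⟩
  exact this.2

theorem mul_diagonal_comm_iff {d : Fin 3 → ℂ} :
    g * diagonal d = diagonal d * g ↔ ∀ i j, d i ≠ d j → g i j = 0 := by
  simp only [← Matrix.ext_iff, mul_diagonal, diagonal_mul]
  refine forall₂_congr fun i j => ?_
  rw [mul_comm (d i), ← sub_eq_zero, ← mul_sub, mul_eq_zero, sub_eq_zero, eq_comm (a := d j)]
  tauto

/-- The centralizer of a diagonal matrix depends only on which diagonal entries agree. -/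
theorem centralizer_diagonal_congr {d e : Fin 3 → ℂ} (hde : ∀ i j, d i = d j ↔ e i = e j) :
    centralizerSU3 (diagonal d) = centralizerSU3 (diagonal e) := by
  ext g
  simp only [centralizerSU3, Set.mem_ofPred_eq, mul_diagonal_comm_iff, ne_eq, hde]

/-- The permutation matrix of a three-cycle. -/
def cyclicMatrix : Matrix (Fin 3) (Fin 3) ℂ := !![0, 1, 0; 0, 0, 1; 1, 0, 0]

theorem cyclicMatrix_mem : cyclicMatrix ∈ SU3 := by
  refine ⟨?_, by simp [cyclicMatrix, det_fin_three]⟩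
  ext i j
  fin_cases i <;> fin_cases j <;> simp [cyclicMatrix, mul_apply, Fin.sum_univ_three]

theorem cyclicMatrix_conj_diagonal (d : Fin 3 → ℂ) :
    cyclicMatrix * diagonal d * cyclicMatrix⁻¹ = diagonal ![d 1, d 2, d 0] := by
  rw [inv_eq cyclicMatrix_mem]
  ext i j
  fin_cases i <;> fin_cases j <;>
    simp [cyclicMatrix, mul_apply, Fin.sum_univ_three, vecMul_diagonal]

theorem conjugate_centralizer_rotate (d : Fin 3 → ℂ) :
    ConjugateInSU3 (centralizerSU3 (diagonal d)) (centralizerSU3 (diagonal ![d 1, d 2, d 0])) := by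
  rw [← cyclicMatrix_conj_diagonal]
  exact conjugate_centralizer_conj cyclicMatrix_mem

theorem conjugate_refl (S : Set (Matrix (Fin 3) (Fin 3) ℂ)) : ConjugateInSU3 S S :=
  ⟨1, by simp [SU3], by simp⟩

theorem diagonal_mem {d : Fin 3 → ℂ} (hd : ∀ i, star (d i) * d i = 1)
    (hdet : d 0 * d 1 * d 2 = 1) : diagonal d ∈ SU3 := by
  refine ⟨?_, by simp [Fin.prod_univ_three, hdet]⟩
  rw [diagonal_conjTranspose, diagonal_mul_diagonal, ← diagonal_one]
  exact congr_arg diagonal (funext hd)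

/-- Every element of `SU(3, ℂ)` is conjugate to a diagonal matrix. -/
theorem exists_conj_eq_diagonal (hA : A ∈ SU3) :
    ∃ g ∈ SU3, ∃ d : Fin 3 → ℂ, g * A * g⁻¹ = diagonal d := by
  obtain ⟨U, hU, d, hd⟩ := exists_unitary_conj_eq_diagonal (mem_unitaryGroup_iff'.mpr hA.1)
  have hdet : star U.det * U.det = 1 := (Unitary.mem_iff.mp (det_of_mem_unitary hU)).1
  have hdet' : U.det * star U.det = 1 := (Unitary.mem_iff.mp (det_of_mem_unitary hU)).2
  set E : Matrix (Fin 3) (Fin 3) ℂ := diagonal ![U.det, 1, 1] with hE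
  have hEE : Eᴴ * E = 1 := by
    rw [hE, diagonal_conjTranspose, diagonal_mul_diagonal, ← diagonal_one]
    congr 1
    ext i
    fin_cases i
    · exact hdet
    all_goals simp
  have hUU : U * Uᴴ = 1 := mem_unitaryGroup_iff.mp hU
  have hg : E * Uᴴ ∈ SU3 := by
    refine ⟨?_, by simpa [hE, Fin.prod_univ_three, det_conjTranspose] using hdet'⟩
    rw [conjTranspose_mul, conjTranspose_conjTranspose]
    calc U * Eᴴ * (E * Uᴴ) = U * (Eᴴ * E) * Uᴴ := by simp only [Matrix.mul_assoc]
      _ = 1 := by rw [hEE, Matrix.mul_one, hUU]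
  refine ⟨E * Uᴴ, hg, d, ?_⟩
  rw [inv_eq hg, conjTranspose_mul, conjTranspose_conjTranspose]
  calc E * Uᴴ * A * (U * Eᴴ) = E * (Uᴴ * A * U) * Eᴴ := by simp only [Matrix.mul_assoc]
    _ = diagonal d * (E * Eᴴ) := by
        rw [hd, hE, ← Matrix.mul_assoc, (commute_diagonal _ d).eq]
    _ = diagonal d := by rw [mul_eq_one_comm.mp hEE, Matrix.mul_one]

theorem conjugate_centralizer_diagonal (d : Fin 3 → ℂ) :
    ConjugateInSU3 (centralizerSU3 (diagonal d)) (centralizerSU3 1) ∨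
    ConjugateInSU3 (centralizerSU3 (diagonal d)) (centralizerSU3 (diagonal ![-1, -1, 1])) ∨
    ConjugateInSU3 (centralizerSU3 (diagonal d))
      (centralizerSU3 (diagonal ![1, Complex.I, -Complex.I])) := by
  have two_eq {e : Fin 3 → ℂ} (h01 : e 0 = e 1) (h02 : e 0 ≠ e 2) :
      ConjugateInSU3 (centralizerSU3 (diagonal e)) (centralizerSU3 (diagonal ![-1, -1, 1])) := by
    rw [centralizer_diagonal_congr (e := ![-1, -1, 1])]
    · exact conjugate_refl _
    · intro i j
      fin_cases i <;> fin_cases j <;>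
        simp [← h01, h02, h02.symm, neg_eq_self, self_eq_neg]
  by_cases h01 : d 0 = d 1
  · by_cases h02 : d 0 = d 2
    · left
      rw [← diagonal_one, centralizer_diagonal_congr (e := fun _ => 1)]
      · exact conjugate_refl _
      · intro i j
        fin_cases i <;> fin_cases j <;> simp [← h01, ← h02]
    · exact .inr (.inl (two_eq h01 h02))
  right
  by_cases h12 : d 1 = d 2
  · exact .inl (conjugate_trans (conjugate_centralizer_rotate d)
      (two_eq (by simpa using h12) (by simpa using Ne.symm h01)))
  by_cases h02 : d 0 = d 2
  · exact .inl (conjugate_trans (conjugate_centralizer_rotate d)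
      (conjugate_trans (conjugate_centralizer_rotate _)
        (two_eq (by simpa using h02.symm) (by simpa using Ne.symm h12))))
  right
  rw [centralizer_diagonal_congr (e := ![1, Complex.I, -Complex.I])]
  · exact conjugate_refl _
  · intro i j
    fin_cases i <;> fin_cases j <;>
      simp [h01, h02, h12, Ne.symm h01, Ne.symm h02, Ne.symm h12, Complex.ext_iff,
        neg_eq_self, self_eq_neg]

theorem commute_of_mem_centralizer_diagonal {d : Fin 3 → ℂ} (hd : Function.Injective d)
    (hg : g ∈ centralizerSU3 (diagonal d)) (hh : h ∈ centralizerSU3 (diagonal d)) :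
    g * h = h * g := by
  have isDiag {x : Matrix (Fin 3) (Fin 3) ℂ} (hx : x ∈ centralizerSU3 (diagonal d)) :
      diagonal x.diag = x :=
    (isDiag_iff_diagonal_diag x).mp fun i j hij => mul_diagonal_comm_iff.mp hx.2 i j (hd.ne hij)
  rw [← isDiag hg, ← isDiag hh]
  exact commute_diagonal _ _

theorem injective_one_I_neg_I : Function.Injective ![1, Complex.I, -Complex.I] := by
  intro i j
  fin_cases i <;> fin_cases j <;>
    simp [Complex.ext_iff, neg_eq_self, self_eq_neg]

theorem not_commute_cyclicMatrix_diagonal {d : Fin 3 → ℂ} (hd : d 1 ≠ d 2) :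
    cyclicMatrix * diagonal d ≠ diagonal d * cyclicMatrix := by
  intro h
  simpa [cyclicMatrix] using mul_diagonal_comm_iff.mp h 1 2 hd

theorem not_conjugate_two_eq_distinct :
    ¬ ConjugateInSU3 (centralizerSU3 (diagonal ![-1, -1, 1]))
      (centralizerSU3 (diagonal ![1, Complex.I, -Complex.I])) := by
  intro hST
  have hx : !![0, 1, 0; -1, 0, 0; 0, 0, 1] ∈ centralizerSU3 (diagonal ![-1, -1, 1]) := by
    refine ⟨⟨?_, by simp [det_fin_three]⟩, ?_⟩ <;> ext i j <;> fin_cases i <;> fin_cases j <;>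
      simp [mul_apply, Fin.sum_univ_three]
  have hy : diagonal ![Complex.I, -Complex.I, 1] ∈ centralizerSU3 (diagonal ![-1, -1, 1]) := by
    refine ⟨diagonal_mem (fun i => ?_) (by simp), commute_diagonal _ _⟩
    fin_cases i <;> simp
  have h := commute_of_conjugate hST
    (fun x hx y hy => commute_of_mem_centralizer_diagonal injective_one_I_neg_I hx hy) hx hy
  simpa using mul_diagonal_comm_iff.mp h 0 1 (by simp [self_eq_neg])

end SU3

/-- There are exactly three conjugacy classes of centralizers of elements in
`SU(3, ℂ)`: there are three pairwise non-conjugate centralizers such that the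
centralizer of every element of `SU(3, ℂ)` is conjugate to one of them. -/
theorem three_conjugacy_classes_of_centralizers_SU3 :
    ∃ A₁ A₂ A₃ : Matrix (Fin 3) (Fin 3) ℂ, A₁ ∈ SU3 ∧ A₂ ∈ SU3 ∧ A₃ ∈ SU3 ∧
      ¬ ConjugateInSU3 (centralizerSU3 A₁) (centralizerSU3 A₂) ∧
      ¬ ConjugateInSU3 (centralizerSU3 A₁) (centralizerSU3 A₃) ∧
      ¬ ConjugateInSU3 (centralizerSU3 A₂) (centralizerSU3 A₃) ∧
      ∀ A ∈ SU3,
        ConjugateInSU3 (centralizerSU3 A) (centralizerSU3 A₁) ∨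
        ConjugateInSU3 (centralizerSU3 A) (centralizerSU3 A₂) ∨
        ConjugateInSU3 (centralizerSU3 A) (centralizerSU3 A₃) := by
  refine ⟨1, diagonal ![-1, -1, 1], diagonal ![1, Complex.I, -Complex.I], by simp [SU3],
    SU3.diagonal_mem (fun i => by fin_cases i <;> simp) (by simp),
    SU3.diagonal_mem (fun i => by fin_cases i <;> simp) (by simp),
    fun h => ?_, fun h => ?_, SU3.not_conjugate_two_eq_distinct, fun A hA => ?_⟩
  · exact SU3.not_commute_cyclicMatrix_diagonal (by simp [neg_eq_self])
      (SU3.commute_of_conjugate_one h SU3.cyclicMatrix_mem)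
  · exact SU3.not_commute_cyclicMatrix_diagonal (by simp [self_eq_neg])
      (SU3.commute_of_conjugate_one h SU3.cyclicMatrix_mem)
  · obtain ⟨g, hg, d, hd⟩ := SU3.exists_conj_eq_diagonal hA
    have hAd : ConjugateInSU3 (centralizerSU3 A) (centralizerSU3 (diagonal d)) :=
      hd ▸ SU3.conjugate_centralizer_conj hg
    exact (SU3.conjugate_centralizer_diagonal d).imp (SU3.conjugate_trans hAd)
      (Or.imp (SU3.conjugate_trans hAd) (SU3.conjugate_trans hAd))
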